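/- Fix Δt > 0, γ ≥ 1, β ∈ [0,1), x ∈ ℝ, let φ : ℝ → ℝ be continuously differentiable, and let ρⁿ, qⁿ : ℝ → ℝ be continuously differentiable with ρⁿ > 0. For ε ∈ (0,1], let q^{n+1}(ε) denote the value at x of the reformulated momentum update qⁿ − (ε^{1+β}Δt/(ε^{1+β}+Δt)) ∂_x((qⁿ)²/ρⁿ) − (ε^{1−β}Δt/(ε^{1+β}+Δt)) ∂_x((ρⁿ)^γ) − (Δt/(ε^{1+β}+Δt))(qⁿ − ρⁿ ∂_x φ). Then lim_{ε→0⁺} q^{n+1}(ε) = ρⁿ(x) ∂_x φ(x), i.e., the updated momentum converges to the equilibrium momentum of the hyperbolic limit system. -/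

import Mathlib

open Real Filter Topology

/-- A positive real power tends to zero as its base tends to zero from the right. -/
lemma tendsto_rpow_nhdsGT_zero {a : ℝ} (ha : 0 < a) :
    Tendsto (fun ε : ℝ => ε ^ a) (𝓝[>] 0) (𝓝 0) := by
  have h := (Real.continuousAt_rpow_const 0 a (Or.inr ha.le)).tendsto
  rw [Real.zero_rpow ha.ne'] at h
  exact h.mono_left nhdsWithin_le_nhds

/-- AP property of the momentum update, hyperbolic scaling β ∈ [0,1): as ε → 0⁺ the
reformulated momentum update converges to the equilibrium momentum `ρ ∂_x φ`. -/
theorem momentum_update_hyperbolic_limit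
    (Δt γ β x : ℝ) (hΔt : 0 < Δt) (hγ : 1 ≤ γ) (hβ : β ∈ Set.Ico (0 : ℝ) 1)
    (φ ρ q : ℝ → ℝ) (hφ : ContDiff ℝ 1 φ) (hρ : ContDiff ℝ 1 ρ) (hq : ContDiff ℝ 1 q)
    (hρpos : ∀ y : ℝ, 0 < ρ y) :
    Tendsto (fun ε : ℝ =>
        q x - (ε ^ (1 + β) * Δt / (ε ^ (1 + β) + Δt)) *
              deriv (fun y => (q y) ^ 2 / ρ y) x
          - (ε ^ (1 - β) * Δt / (ε ^ (1 + β) + Δt)) * deriv (fun y => ρ y ^ γ) x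
          - (Δt / (ε ^ (1 + β) + Δt)) * (q x - ρ x * deriv φ x))
      (nhdsWithin 0 (Set.Ioi 0))
      (nhds (ρ x * deriv φ x)) := by
  have hplus := tendsto_rpow_nhdsGT_zero (a := 1 + β) (by linarith [hβ.1])
  have hminus := tendsto_rpow_nhdsGT_zero (a := 1 - β) (by linarith [hβ.2])
  have hden := hplus.add_const Δt
  have hne : 0 + Δt ≠ 0 := by simpa using hΔt.ne'
  have hflux := ((hplus.mul_const Δt).div hden hne).mul_const
    (deriv (fun y => (q y) ^ 2 / ρ y) x)
  have hpressure := ((hminus.mul_const Δt).div hden hne).mul_const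
    (deriv (fun y => ρ y ^ γ) x)
  have hrelax := ((tendsto_const_nhds (x := Δt)).div hden hne).mul_const
    (q x - ρ x * deriv φ x)
  have hlim := (((tendsto_const_nhds (x := q x)).sub hflux).sub hpressure).sub hrelax
  simpa [hΔt.ne'] using hlim
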